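/- (Rüssmann's small-divisor estimate.) Let ω ∈ ℝ^d satisfy |⟨k,ω⟩ + j| ≥ κ/|k|^τ for all k ∈ ℤ^d \ {0} and all j ∈ ℤ, where 0 < κ < 1 and τ > 0. Then there is a constant C = C(τ) such that for every n ≥ 1, the sum of |a|^{−2} over all distinct nonzero real numbers a in the set {⟨k,ω⟩ + l : k ∈ ℤ^d, |k| ≤ n, l ∈ ℤ} is at most C κ^{−2} n^{2τ}. -/

import Mathlib

open Real

noncomputable section

/-- Diophantine condition: `|⟨k,ω⟩ + j| ≥ κ/|k|^τ` for all `k ∈ ℤ^d \ {0}`, `j ∈ ℤ`,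
where `|k| = |k₁|+⋯+|k_d|`. -/
def DiophCond (d : ℕ) (ω : Fin d → ℝ) (κ τ : ℝ) : Prop :=
  ∀ (k : Fin d → ℤ) (j : ℤ), k ≠ 0 →
    κ / (∑ i, |(k i : ℝ)|) ^ τ ≤ |(∑ i, (k i : ℝ) * ω i) + (j : ℝ)|

theorem russmann_sep (d : ℕ) (ω : Fin d → ℝ) (κ τ : ℝ) (hτ : 0 < τ) (hκ : 0 < κ) (hκ1 : κ < 1)
    (h : DiophCond d ω κ τ) (n : ℕ) (hn : 1 ≤ n) (k k' : Fin d → ℤ) (l l' : ℤ)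
    (hk : (∑ i, |k i|) ≤ (n : ℤ)) (hk' : (∑ i, |k' i|) ≤ (n : ℤ))
    (hne : (∑ i, (k i : ℝ) * ω i) + (l : ℝ) ≠ (∑ i, (k' i : ℝ) * ω i) + (l' : ℝ)) :
    κ / (2 * (n : ℝ)) ^ τ ≤
      |((∑ i, (k i : ℝ) * ω i) + (l : ℝ)) - ((∑ i, (k' i : ℝ) * ω i) + (l' : ℝ))| := by
  have hn' : (1 : ℝ) ≤ n := by exact_mod_cast hn
  by_cases hkk : k = k'
  · subst hkk
    have hl : l - l' ≠ 0 := by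
      intro h0
      apply hne
      rw [sub_eq_zero.mp h0]
    have h1 : (1 : ℝ) ≤ |((l - l' : ℤ) : ℝ)| := by exact_mod_cast Int.one_le_abs hl
    have h2 : (1 : ℝ) ≤ (2 * (n : ℝ)) ^ τ := Real.one_le_rpow (by linarith) hτ.le
    have h3 : κ / (2 * (n : ℝ)) ^ τ ≤ 1 := by
      rw [div_le_one (by linarith)]; linarith
    rw [add_sub_add_left_eq_sub]
    push_cast at h1
    linarith
  · have hd : k - k' ≠ 0 := sub_ne_zero.mpr hkk
    have h1 := h (k - k') (l - l') hd
    have hsum : (∑ i, |((k - k') i : ℝ)|) ≤ 2 * n := by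
      have e : (∑ i, |(k - k') i|) ≤ 2 * (n : ℤ) := by
        calc (∑ i, |(k - k') i|) ≤ ∑ i, (|k i| + |k' i|) :=
              Finset.sum_le_sum (fun i _ => abs_sub (k i) (k' i))
          _ ≤ 2 * (n : ℤ) := by rw [Finset.sum_add_distrib]; linarith
      exact_mod_cast e
    have hpos : 0 < ∑ i, |((k - k') i : ℝ)| := by
      obtain ⟨i, hi⟩ := Function.ne_iff.mp hd
      apply Finset.sum_pos' (fun i _ => abs_nonneg _)
      exact ⟨i, Finset.mem_univ i, abs_pos.mpr (by exact_mod_cast hi)⟩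
    have h2 : κ / (2 * (n : ℝ)) ^ τ ≤ κ / (∑ i, |((k - k') i : ℝ)|) ^ τ := by
      apply div_le_div_of_nonneg_left hκ.le (Real.rpow_pos_of_pos hpos τ)
      exact Real.rpow_le_rpow hpos.le hsum hτ.le
    refine h2.trans (h1.trans (le_of_eq ?_))
    congr 1
    simp only [Pi.sub_apply, Int.cast_sub, sub_mul, Finset.sum_sub_distrib]
    ring

/-- Rüssmann's small-divisor estimate: the sum of `|a|⁻²` over the distinct nonzero
values `a = ⟨k,ω⟩ + l` with `|k| ≤ n`, `l ∈ ℤ`, is at most `C κ⁻² n^{2τ}`. -/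
theorem russmann_small_divisor_estimate (τ : ℝ) (hτ : 0 < τ) :
    ∃ C : ℝ, 0 < C ∧
      ∀ (d : ℕ), 1 ≤ d → ∀ (ω : Fin d → ℝ) (κ : ℝ), 0 < κ → κ < 1 →
        DiophCond d ω κ τ → ∀ n : ℕ, 1 ≤ n →
          ∑' a : ({x : ℝ | ∃ (k : Fin d → ℤ) (l : ℤ),
                      (∑ i, |k i|) ≤ (n : ℤ) ∧ x = (∑ i, (k i : ℝ) * ω i) + (l : ℝ)} \
                    {0} : Set ℝ),
            ENNReal.ofReal (1 / (a : ℝ) ^ 2) ≤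
              ENNReal.ofReal (C * κ⁻¹ ^ 2 * (n : ℝ) ^ (2 * τ)) := by
  have hS : Summable (fun m : ℤ => 1 / (m : ℝ) ^ 2) :=
    Real.summable_one_div_int_pow.mpr (by norm_num)
  have hS0 : 0 ≤ ∑' m : ℤ, 1 / (m : ℝ) ^ 2 := tsum_nonneg (fun m => by positivity)
  have h2τ : (0 : ℝ) < 2 ^ τ := by positivity
  refine ⟨4 * ((2 : ℝ) ^ τ) ^ 2 * ((∑' m : ℤ, 1 / (m : ℝ) ^ 2) + 1), by positivity, ?_⟩
  intro d _ ω κ hκ hκ1 h n hn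
  have hn' : (1 : ℝ) ≤ n := by exact_mod_cast hn
  set δ : ℝ := κ / (2 * (n : ℝ)) ^ τ with hδ
  have hδ0 : 0 < δ := by positivity
  have hsep := russmann_sep d ω κ τ hτ hκ hκ1 h n hn
  set A : Set ℝ := ({x : ℝ | ∃ (k : Fin d → ℤ) (l : ℤ),
      (∑ i, |k i|) ≤ (n : ℤ) ∧ x = (∑ i, (k i : ℝ) * ω i) + (l : ℝ)} \ {0} : Set ℝ) with hA
  have hinj : Function.Injective (fun a : A => ⌊(a : ℝ) / δ⌋) := by
    rintro ⟨a, ⟨k, l, hk, ha⟩, ha0⟩ ⟨b, ⟨k', l', hk', hb⟩, hb0⟩ hab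
    simp only at hab
    apply Subtype.ext
    by_contra hne
    simp only at hne
    have h1 := hsep k k' l l' hk hk' (by rw [← ha, ← hb]; exact hne)
    rw [← ha, ← hb] at h1
    have h2 := Int.abs_sub_lt_one_of_floor_eq_floor hab
    rw [← sub_div, abs_div, abs_of_pos hδ0, div_lt_one hδ0] at h2
    linarith
  have hbd : ∀ a : A, ENNReal.ofReal (1 / (a : ℝ) ^ 2) ≤
      ENNReal.ofReal (4 / δ ^ 2 * (1 / (⌊(a : ℝ) / δ⌋ : ℝ) ^ 2)) := by
    rintro ⟨a, ⟨k, l, hk, ha⟩, ha0⟩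
    apply ENNReal.ofReal_le_ofReal
    simp only
    have ha0' : a ≠ 0 := ha0
    have h1 := hsep k 0 l 0 hk (by simp) (by rw [← ha]; simpa using ha0')
    rw [← ha] at h1
    simp only [Pi.zero_apply, Int.cast_zero, zero_mul, Finset.sum_const_zero, add_zero,
      sub_zero] at h1
    obtain ⟨x, rfl⟩ : ∃ x, a = x * δ := ⟨a / δ, by field_simp⟩
    rw [mul_div_cancel_right₀ _ hδ0.ne']
    have hx : 1 ≤ |x| := by
      rw [abs_mul, abs_of_pos hδ0] at h1
      by_contra hc
      push Not at hc
      nlinarith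
    have hf1 := Int.floor_le x
    have hf2 := Int.lt_floor_add_one x
    have hm : (⌊x⌋ : ℝ) ≠ 0 := by
      intro h0
      rw [h0] at hf1 hf2
      rw [abs_of_nonneg hf1] at hx
      linarith
    have hm2 : (⌊x⌋ : ℝ) ^ 2 ≤ 4 * x ^ 2 := by
      have : |(⌊x⌋ : ℝ)| ≤ |2 * x| := by
        rw [abs_mul, abs_two]
        have : |(⌊x⌋ : ℝ)| ≤ |x| + 1 := by
          rw [abs_le]
          constructor <;> linarith [neg_abs_le x, le_abs_self x]
        linarith
      have := sq_le_sq.mpr this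
      linarith
    have hx0 : x ≠ 0 := by rintro rfl; simp at ha0'
    have hx2 : 0 < x ^ 2 := by positivity
    have hm3 : 0 < (⌊x⌋ : ℝ) ^ 2 := by positivity
    rw [div_mul_div_comm, mul_one, div_le_div_iff₀ (by positivity) (by positivity)]
    nlinarith [mul_le_mul_of_nonneg_left hm2 (sq_nonneg δ)]
  calc ∑' a : A, ENNReal.ofReal (1 / (a : ℝ) ^ 2)
      ≤ ∑' a : A, ENNReal.ofReal (4 / δ ^ 2 * (1 / (⌊(a : ℝ) / δ⌋ : ℝ) ^ 2)) :=
        ENNReal.tsum_le_tsum hbd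
    _ ≤ ∑' m : ℤ, ENNReal.ofReal (4 / δ ^ 2 * (1 / (m : ℝ) ^ 2)) :=
        ENNReal.tsum_comp_le_tsum_of_injective hinj
          (fun m : ℤ => ENNReal.ofReal (4 / δ ^ 2 * (1 / (m : ℝ) ^ 2)))
    _ = ENNReal.ofReal (∑' m : ℤ, 4 / δ ^ 2 * (1 / (m : ℝ) ^ 2)) :=
        (ENNReal.ofReal_tsum_of_nonneg (fun m => by positivity) (hS.mul_left _)).symm
    _ ≤ _ := by
        apply ENNReal.ofReal_le_ofReal
        rw [tsum_mul_left]
        have hnn : (n : ℝ) ^ (2 * τ) = ((n : ℝ) ^ τ) ^ 2 := by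
          rw [mul_comm, Real.rpow_mul (by positivity)]
          norm_cast
        have hδ2 : 4 / δ ^ 2 = 4 * ((2 : ℝ) ^ τ) ^ 2 * κ⁻¹ ^ 2 * (n : ℝ) ^ (2 * τ) := by
          rw [hnn, hδ, Real.mul_rpow (by norm_num) (by positivity)]
          field_simp
        have hp : 0 < 4 / δ ^ 2 := by positivity
        calc 4 / δ ^ 2 * ∑' m : ℤ, 1 / (m : ℝ) ^ 2
            ≤ 4 / δ ^ 2 * ((∑' m : ℤ, 1 / (m : ℝ) ^ 2) + 1) := by
              apply mul_le_mul_of_nonneg_left _ hp.le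
              linarith
          _ = _ := by rw [hδ2]; ring
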